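/- There exists a universal constant c > 0 with the following property. Let n ≥ 8, let M be an n×n non-random real matrix with zero diagonal, and let σ be a uniform random permutation of {1,…,n}. Let T be the ⌊n/2⌋×⌊n/2⌋ submatrix of σ(M) located in its top right corner. Then with probability at least c (over the choice of σ), ‖T‖ ≥ c·‖M‖. -/

import Mathlib

open MeasureTheory ProbabilityTheory Matrix Finset
open scoped ENNReal

/-- The spectral norm (ℓ₂ → ℓ₂ operator norm) of a real matrix. -/
noncomputable def specNorm {m n : ℕ} (A : Matrix (Fin m) (Fin n) ℝ) : ℝ :=
  ‖LinearMap.toContinuousLinearMap (Matrix.toEuclideanLin A)‖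

/-- The ⌊n/2⌋ × ⌊n/2⌋ top right corner of an n × n matrix. -/
def corner {n : ℕ} (B : Matrix (Fin n) (Fin n) ℝ) :
    Matrix (Fin (n / 2)) (Fin (n / 2)) ℝ :=
  fun i j => B ⟨i.1, lt_of_lt_of_le i.2 (Nat.div_le_self n 2)⟩
    ⟨n - n / 2 + j.1, by have := j.2; omega⟩

instance permMeasurableSpace {n : ℕ} : MeasurableSpace (Equiv.Perm (Fin n)) := ⊤

lemma specNorm_nonneg {m n : ℕ} (A : Matrix (Fin m) (Fin n) ℝ) : 0 ≤ specNorm A :=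
  norm_nonneg _

lemma norm_toEuclideanLin_le {m n : ℕ} (A : Matrix (Fin m) (Fin n) ℝ)
    (v : EuclideanSpace ℝ (Fin n)) :
    ‖Matrix.toEuclideanLin A v‖ ≤ specNorm A * ‖v‖ :=
  (LinearMap.toContinuousLinearMap (Matrix.toEuclideanLin A)).le_opNorm v

lemma specNorm_le_of_forall {m n : ℕ} (A : Matrix (Fin m) (Fin n) ℝ) {K : ℝ} (hK : 0 ≤ K)
    (h : ∀ v, ‖Matrix.toEuclideanLin A v‖ ≤ K * ‖v‖) : specNorm A ≤ K :=
  ContinuousLinearMap.opNorm_le_bound _ hK h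

lemma inner_toEuclideanLin {m n : ℕ} (A : Matrix (Fin m) (Fin n) ℝ)
    (u : EuclideanSpace ℝ (Fin m)) (v : EuclideanSpace ℝ (Fin n)) :
    inner ℝ u (Matrix.toEuclideanLin A v) = ∑ i, ∑ j, u i * A i j * v j := by
  simp only [PiLp.inner_apply, Matrix.toLpLin_apply, Matrix.mulVec, dotProduct,
    RCLike.inner_apply, conj_trivial, Finset.sum_mul]
  refine Finset.sum_congr rfl fun i _ => Finset.sum_congr rfl fun j _ => by ring

lemma norm_comp_injective_le {m n : ℕ} {e : Fin m → Fin n} (he : Function.Injective e)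
    (u : EuclideanSpace ℝ (Fin n)) :
    ‖(WithLp.toLp 2 fun i => u (e i) : EuclideanSpace ℝ (Fin m))‖ ≤ ‖u‖ := by
  rw [EuclideanSpace.norm_eq, EuclideanSpace.norm_eq]
  apply Real.sqrt_le_sqrt
  calc ∑ i, ‖u (e i)‖ ^ 2 = ∑ k ∈ univ.map ⟨e, he⟩, ‖u k‖ ^ 2 := by simp
    _ ≤ ∑ k, ‖u k‖ ^ 2 :=
        Finset.sum_le_sum_of_subset_of_nonneg (subset_univ _) fun _ _ _ => by positivity

lemma sum_extend_zero {m n : ℕ} {f : Fin m → Fin n} (hf : Function.Injective f)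
    (w : Fin m → ℝ) (g : Fin n → ℝ → ℝ) (hg : ∀ k, g k 0 = 0) :
    ∑ k, g k (Function.extend f w 0 k) = ∑ j, g (f j) (w j) := by
  symm
  refine Finset.sum_of_injOn f hf.injOn (by simp) (fun k _ hk => ?_) (fun j _ => ?_)
  · rw [Function.extend_apply' _ _ _ (by simpa using hk)]
    exact hg k
  · rw [hf.extend_apply]

/-- The spectral norm of a submatrix is at most that of the matrix. -/
lemma specNorm_submatrix_le {m n : ℕ} (A : Matrix (Fin n) (Fin n) ℝ) {e f : Fin m → Fin n}
    (he : Function.Injective e) (hf : Function.Injective f) :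
    specNorm (A.submatrix e f) ≤ specNorm A := by
  refine specNorm_le_of_forall _ (specNorm_nonneg A) fun w => ?_
  set w' : EuclideanSpace ℝ (Fin n) := WithLp.toLp 2 (Function.extend f w 0) with hw'
  have hnorm : ‖w'‖ = ‖w‖ := by
    rw [EuclideanSpace.norm_eq, EuclideanSpace.norm_eq]
    congr 1
    exact sum_extend_zero hf w (fun _ x => ‖x‖ ^ 2) (by simp)
  have happ : Matrix.toEuclideanLin (A.submatrix e f) w
      = WithLp.toLp 2 fun i => Matrix.toEuclideanLin A w' (e i) := by
    ext i
    simp only [Matrix.toLpLin_apply, Matrix.mulVec, dotProduct, Matrix.submatrix_apply]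
    exact (sum_extend_zero hf w (fun k x => A (e i) k * x) (by simp)).symm
  rw [happ, ← hnorm]
  exact (norm_comp_injective_le he _).trans (norm_toEuclideanLin_le A w')

lemma sum_submatrix_le {m n : ℕ} (A : Matrix (Fin n) (Fin n) ℝ) {e f : Fin m → Fin n}
    (he : Function.Injective e) (hf : Function.Injective f) (u v : EuclideanSpace ℝ (Fin n)) :
    ∑ i, ∑ j, u (e i) * A (e i) (f j) * v (f j) ≤ specNorm (A.submatrix e f) * (‖u‖ * ‖v‖) := by
  have h := inner_toEuclideanLin (A.submatrix e f) (WithLp.toLp 2 fun i => u (e i))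
    (WithLp.toLp 2 fun j => v (f j))
  simp only [Matrix.submatrix_apply] at h
  rw [← h]
  refine (real_inner_le_norm _ _).trans ?_
  calc _ ≤ ‖u‖ * (specNorm (A.submatrix e f) * ‖v‖) := by
        refine mul_le_mul (norm_comp_injective_le he u) ?_ (norm_nonneg _) (norm_nonneg _)
        exact (norm_toEuclideanLin_le _ _).trans
          (mul_le_mul_of_nonneg_left (norm_comp_injective_le hf v) (specNorm_nonneg _))
    _ = _ := by ring

/-- The sum of `g (σ a) (σ b)` over all permutations does not depend on the pair `a ≠ b`. -/
lemma sum_perm_apply_pair_eq {α : Type*} [Fintype α] [DecidableEq α] (g : α → α → ℝ)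
    {a b a' b' : α} (h : a ≠ b) (h' : a' ≠ b') :
    ∑ π : Equiv.Perm α, g (π a) (π b) = ∑ π : Equiv.Perm α, g (π a') (π b') := by
  obtain ⟨τ, ha, hb⟩ := MulAction.is_two_pretransitive_iff.mp
    (Equiv.Perm.isMultiplyPretransitive α 2) h' h
  rw [← Equiv.sum_comp (Equiv.mulRight τ) fun π : Equiv.Perm α => g (π a') (π b')]
  simp only [Equiv.Perm.smul_def] at ha hb
  simp [ha, hb]

lemma sum_perm_apply_pair {α : Type*} [Fintype α] [DecidableEq α] (g : α → α → ℝ)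
    (hg : ∀ x, g x x = 0) {a b : α} (h : a ≠ b) :
    ((Fintype.card α : ℝ) * (Fintype.card α - 1)) * ∑ π : Equiv.Perm α, g (π a) (π b)
      = Fintype.card (Equiv.Perm α) * ∑ x, ∑ y, g x y := by
  have hsum : ∑ x, ∑ y, ∑ π : Equiv.Perm α, g (π x) (π y)
      = Fintype.card (Equiv.Perm α) * ∑ x, ∑ y, g x y := by
    calc _ = ∑ π : Equiv.Perm α, ∑ x, ∑ y, g (π x) (π y) := by
          rw [Finset.sum_congr rfl fun x _ => Finset.sum_comm]
          exact Finset.sum_comm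
      _ = ∑ π : Equiv.Perm α, ∑ x, ∑ y, g x y := by
          refine Finset.sum_congr rfl fun π _ => ?_
          simp_rw [Equiv.sum_comp π (g _)]
          exact Equiv.sum_comp π fun x => ∑ y, g x y
      _ = _ := by simp
  rw [← hsum]
  have hrow (x : α) : ∑ y, ∑ π : Equiv.Perm α, g (π x) (π y)
      = ((Fintype.card α : ℝ) - 1) * ∑ π : Equiv.Perm α, g (π a) (π b) := by
    rw [← Finset.add_sum_erase _ _ (mem_univ x)]
    rw [Finset.sum_congr rfl fun y hy =>
      sum_perm_apply_pair_eq g (Finset.ne_of_mem_erase hy).symm h]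
    have : 1 ≤ Fintype.card α := Fintype.card_pos_iff.mpr ⟨x⟩
    simp [hg, Finset.card_erase_of_mem, Nat.cast_sub this]
  simp_rw [hrow]
  simp [mul_assoc]

/-- The average spectral norm of the corner of a randomly permuted zero-diagonal matrix. -/
lemma two_ninths_specNorm_le_sum_corner {n : ℕ} (hn : 8 ≤ n) (M : Matrix (Fin n) (Fin n) ℝ)
    (hM : ∀ i, M i i = 0) :
    2 / 9 * Fintype.card (Equiv.Perm (Fin n)) * specNorm M
      ≤ ∑ π : Equiv.Perm (Fin n), specNorm (corner (M.submatrix π π)) := by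
  set N : ℝ := (Fintype.card (Equiv.Perm (Fin n)) : ℝ) with hN
  have hNpos : 0 < N := by rw [hN]; exact_mod_cast Fintype.card_pos
  set S := ∑ π : Equiv.Perm (Fin n), specNorm (corner (M.submatrix π π)) with hS
  have hS0 : 0 ≤ S := Finset.sum_nonneg fun _ _ => specNorm_nonneg _
  let e : Fin (n / 2) → Fin n := fun i => ⟨i.1, lt_of_lt_of_le i.2 (Nat.div_le_self n 2)⟩
  let f : Fin (n / 2) → Fin n := fun j => ⟨n - n / 2 + j.1, by have := j.2; omega⟩
  have he : Function.Injective e := fun i j h => Fin.ext (by simpa [e] using h)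
  have hf : Function.Injective f := fun i j h => Fin.ext (by simpa [f] using h)
  have hef (i j) : e i ≠ f j := fun h => by
    have := congrArg Fin.val h
    simp only [e, f] at this
    omega
  have bilin (u v : EuclideanSpace ℝ (Fin n)) :
      2 / 9 * N * inner ℝ u (Matrix.toEuclideanLin M v) ≤ S * (‖u‖ * ‖v‖) := by
    let g : Fin n → Fin n → ℝ := fun x y => u x * M x y * v y
    let i₀ : Fin (n / 2) := ⟨0, by omega⟩
    set Q := ∑ π : Equiv.Perm (Fin n), g (π (e i₀)) (π (f i₀)) with hQ
    have hQe : (n : ℝ) * (n - 1) * Q = N * inner ℝ u (Matrix.toEuclideanLin M v) := by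
      have := sum_perm_apply_pair g (by simp [g, hM]) (hef i₀ i₀)
      rw [inner_toEuclideanLin]
      simpa using this
    have hle : (n / 2 : ℕ) * ((n / 2 : ℕ) * Q) ≤ S * (‖u‖ * ‖v‖) := by
      calc ((n / 2 : ℕ) : ℝ) * ((n / 2 : ℕ) * Q)
          = ∑ i, ∑ j, ∑ π : Equiv.Perm (Fin n), g (π (e i)) (π (f j)) := by
            simp_rw [fun i j => sum_perm_apply_pair_eq g (hef i j) (hef i₀ i₀), ← hQ]
            simp
        _ = ∑ π : Equiv.Perm (Fin n), ∑ i, ∑ j, g (π (e i)) (π (f j)) := by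
            rw [Finset.sum_congr rfl fun i _ => Finset.sum_comm]
            exact Finset.sum_comm
        _ ≤ S * (‖u‖ * ‖v‖) := by
            rw [hS, Finset.sum_mul]
            exact Finset.sum_le_sum fun π _ =>
              sum_submatrix_le M (π.injective.comp he) (π.injective.comp hf) u v
    have hn' : (8 : ℝ) ≤ n := by exact_mod_cast hn
    rcases le_total 0 Q with hQ0 | hQ0
    · have hm : 2 / 9 * ((n : ℝ) * (n - 1)) ≤ ((n / 2 : ℕ) : ℝ) * ((n / 2 : ℕ) : ℝ) := by
        have h1 : (4 : ℝ) ≤ (n / 2 : ℕ) := by exact_mod_cast (by omega : 4 ≤ n / 2)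
        have h2 : (n : ℝ) ≤ 2 * (n / 2 : ℕ) + 1 := by
          exact_mod_cast (by omega : n ≤ 2 * (n / 2) + 1)
        nlinarith
      nlinarith [mul_le_mul_of_nonneg_right hm hQ0]
    · have : 0 ≤ S * (‖u‖ * ‖v‖) := by positivity
      nlinarith [mul_nonneg (mul_nonneg (by linarith : (0 : ℝ) ≤ n)
        (by linarith : (0 : ℝ) ≤ n - 1)) (neg_nonneg.mpr hQ0)]
  have hpos : 0 < 2 / 9 * N := by positivity
  rw [mul_comm, ← le_div_iff₀ hpos]
  refine specNorm_le_of_forall _ (by positivity) fun v => ?_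
  have h := bilin (Matrix.toEuclideanLin M v) v
  rw [real_inner_self_eq_norm_sq] at h
  rw [div_mul_eq_mul_div, le_div_iff₀ hpos]
  rcases (norm_nonneg (Matrix.toEuclideanLin M v)).eq_or_lt with h0 | h0
  · rw [← h0]
    simpa using mul_nonneg hS0 (norm_nonneg v)
  · refine le_of_mul_le_mul_right ?_ h0
    nlinarith

lemma specNorm_corner_le {n : ℕ} (M : Matrix (Fin n) (Fin n) ℝ) (π : Equiv.Perm (Fin n)) :
    specNorm (corner (M.submatrix π π)) ≤ specNorm M :=
  specNorm_submatrix_le M (e := fun i => π ⟨i.1, lt_of_lt_of_le i.2 (Nat.div_le_self n 2)⟩)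
    (f := fun j => π ⟨n - n / 2 + j.1, by have := j.2; omega⟩)
    (fun i j h => Fin.ext (by simpa using h)) (fun i j h => Fin.ext (by simpa using h))

/-- A reverse Markov inequality for averages over a finite type. -/
lemma card_le_card_filter_of_sum_ge {ι : Type*} [Fintype ι] (X : ι → ℝ) {K p c : ℝ}
    (hK : 0 < K) (hc : 0 ≤ c) (hX : ∀ i, X i ≤ K)
    (hsum : p * Fintype.card ι * K ≤ ∑ i, X i) :
    (p - c) * Fintype.card ι ≤ #{i | c * K ≤ X i} := by
  have h : ∑ i, X i ≤ ∑ i, ((if c * K ≤ X i then K else 0) + c * K) :=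
    Finset.sum_le_sum fun i _ => by
      have := hX i
      have := mul_nonneg hc hK.le
      split_ifs <;> linarith
  rw [Finset.sum_add_distrib, ← Finset.sum_filter] at h
  simp only [Finset.sum_const, nsmul_eq_mul, Finset.card_univ] at h
  refine le_of_mul_le_mul_right ?_ hK
  linarith

lemma measure_uniform_eq_card_div {Ω ι : Type*} [MeasurableSpace Ω] [Fintype ι]
    [MeasurableSpace ι] [MeasurableSingletonClass ι] {μ : Measure Ω} {X : Ω → ι}
    (hX : Measurable X) (hunif : ∀ i, μ {ω | X ω = i} = (Fintype.card ι : ℝ≥0∞)⁻¹)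
    (s : Finset ι) :
    μ {ω | X ω ∈ s} = #s * (Fintype.card ι : ℝ≥0∞)⁻¹ := by
  have hset : {ω | X ω ∈ s} = ⋃ i ∈ s, {ω | X ω = i} := by ext; simp
  rw [hset, measure_biUnion_finset]
  · simp [hunif]
  · intro i _ j _ hij
    exact Set.disjoint_left.mpr fun ω hi hj => hij (hi.symm.trans hj)
  · exact fun i _ => hX (measurableSet_singleton i)

/-- **Lemma 4.** There is a universal constant `c > 0` such that for any `n ≥ 8`, any
non-random `n × n` matrix `M` with zero diagonal, and a uniform random permutation `σ`
of `{1,…,n}`, with probability at least `c` the top right `⌊n/2⌋ × ⌊n/2⌋` corner `T`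
of `σ(M)` satisfies `‖T‖ ≥ c‖M‖`. -/
theorem stmt_5 :
    ∃ c : ℝ, 0 < c ∧
      ∀ (n : ℕ), 8 ≤ n →
      ∀ M : Matrix (Fin n) (Fin n) ℝ,
        (∀ i, M i i = 0) →
        ∀ (Ω : Type) (_ : MeasurableSpace Ω) (μ : Measure Ω), IsProbabilityMeasure μ →
        ∀ σ : Ω → Equiv.Perm (Fin n),
          Measurable σ →
          (∀ π : Equiv.Perm (Fin n),
            μ {ω | σ ω = π} = ((Fintype.card (Equiv.Perm (Fin n)) : ℝ≥0∞))⁻¹) →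
          ENNReal.ofReal c ≤
            μ {ω | c * specNorm M ≤ specNorm (corner (M.submatrix (σ ω) (σ ω)))} := by
  refine ⟨1 / 9, by norm_num, fun n hn M hM Ω _ μ _ σ hσ hunif => ?_⟩
  set G : Finset (Equiv.Perm (Fin n)) :=
    {π | 1 / 9 * specNorm M ≤ specNorm (corner (M.submatrix π π))} with hG
  have hNpos : (0 : ℝ) < Fintype.card (Equiv.Perm (Fin n)) := by
    exact_mod_cast Fintype.card_pos
  have hcard : 1 / 9 * (Fintype.card (Equiv.Perm (Fin n)) : ℝ) ≤ #G := by
    rcases (specNorm_nonneg M).eq_or_lt with h0 | h0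
    · have : G = univ := by
        rw [hG, ← h0]
        simp [specNorm_nonneg]
      rw [this, Finset.card_univ]
      linarith
    · have := card_le_card_filter_of_sum_ge (c := 1 / 9) _ h0 (by norm_num)
        (specNorm_corner_le M) (two_ninths_specNorm_le_sum_corner hn M hM)
      refine le_trans (le_of_eq ?_) this
      ring
  have hμ := measure_uniform_eq_card_div hσ hunif G
  simp only [hG, Finset.mem_filter, Finset.mem_univ, true_and] at hμ
  rw [hμ, ← hG, ← div_eq_mul_inv]
  have hdiv : (#G : ℝ≥0∞) / (Fintype.card (Equiv.Perm (Fin n)) : ℝ≥0∞)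
      = ENNReal.ofReal (#G / Fintype.card (Equiv.Perm (Fin n))) := by
    rw [ENNReal.ofReal_div_of_pos hNpos, ENNReal.ofReal_natCast, ENNReal.ofReal_natCast]
  rw [hdiv]
  exact ENNReal.ofReal_le_ofReal ((le_div_iff₀ hNpos).mpr hcard)
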